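/- arXiv:2509.03397 — 3 statements merged into one kernel-verified Lean document; each statement's English description precedes it below -/
import Mathlib

section
/- Let p, q, r be positive integers with q + 2p ≥ q r ≥ 2p > 0, and let (P_n(x))_{n≥0} be real polynomials with P_0(x) = 1 satisfying P_{n+1}(x) = (q n x + (q r − p) x + p) P_n(x) + q x (1 − x) P_n'(x) for all n ≥ 0. Then for every n ≥ 1 the polynomial P_n(x) has degree n, P_n(x) is bi-gamma-positive, and the reciprocal polynomial x^n P_n(1/x) is ratio monotone. -/
open Polynomial

/-- A real polynomial `p` (with symmetric coefficients) is gamma-positive if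
`p = ∑ γ k * X^k * (1+X)^(deg p - 2k)` with all `γ k ≥ 0`. -/
def GammaPositive (p : Polynomial ℝ) : Prop :=
  ∃ γ : ℕ → ℝ, (∀ k, 0 ≤ γ k) ∧
    p = ∑ k ∈ Finset.range (p.natDegree / 2 + 1),
      Polynomial.C (γ k) * Polynomial.X ^ k * (1 + Polynomial.X) ^ (p.natDegree - 2 * k)

/-- A real polynomial `f` of degree `n` is bi-gamma-positive if both parts of its
symmetric decomposition `f = a + X * b`, where
`a = (f - X^(n+1) f(1/X))/(1 - X)` and `b = (X^n f(1/X) - f)/(1 - X)`,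
are gamma-positive.  (Here `X^n f(1/X)` is `Polynomial.reflect n f`.) -/
def BiGammaPositive (f : Polynomial ℝ) : Prop :=
  ∃ a b : Polynomial ℝ,
    (1 - Polynomial.X) * a = f - Polynomial.X * Polynomial.reflect f.natDegree f ∧
    (1 - Polynomial.X) * b = Polynomial.reflect f.natDegree f - f ∧
    GammaPositive a ∧ GammaPositive b

/-- A real polynomial `p = a_0 + a_1 X + ⋯ + a_n X^n` of degree `n` with positive
coefficients is ratio monotone if
`a_n/a_0 ≤ a_(n-1)/a_1 ≤ ⋯ ≤ a_(n-⌊(n-1)/2⌋)/a_(⌊(n-1)/2⌋) ≤ 1` and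
`a_0/a_(n-1) ≤ a_1/a_(n-2) ≤ ⋯ ≤ a_(⌊n/2⌋-1)/a_(n-⌊n/2⌋) ≤ 1`. -/
def RatioMonotone (p : Polynomial ℝ) : Prop :=
  (∀ i ≤ p.natDegree, 0 < p.coeff i) ∧
  (∀ i : ℕ, i + 1 ≤ (p.natDegree - 1) / 2 →
    p.coeff (p.natDegree - i) / p.coeff i ≤
      p.coeff (p.natDegree - (i + 1)) / p.coeff (i + 1)) ∧
  (p.coeff (p.natDegree - (p.natDegree - 1) / 2) / p.coeff ((p.natDegree - 1) / 2) ≤ 1) ∧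
  (∀ i : ℕ, i + 2 ≤ p.natDegree / 2 →
    p.coeff i / p.coeff (p.natDegree - 1 - i) ≤
      p.coeff (i + 1) / p.coeff (p.natDegree - 1 - (i + 1))) ∧
  (1 ≤ p.natDegree / 2 →
    p.coeff (p.natDegree / 2 - 1) / p.coeff (p.natDegree - p.natDegree / 2) ≤ 1)

theorem two_mul_le_add_of_le {a b x y z : ℝ} (ha : 0 ≤ a) (hb : 0 ≤ b) (hz : 0 ≤ z)
    (hzx : z ≤ x) (hzy : z ≤ y) (hab : a * b = x * y) : 2 * z ≤ a + b := by
  have h : z * z ≤ a * b := hab ▸ mul_le_mul hzx hzy hz (hz.trans hzx)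
  nlinarith [sq_nonneg (a - b)]

/-- The ratio conditions of `RatioMonotone` in product form, for a two-sided sequence that is
positive on `[0, n]` and zero elsewhere. -/
structure RatioSpiral (n : ℤ) (u : ℤ → ℝ) : Prop where
  pos : ∀ i, 0 ≤ i → i ≤ n → 0 < u i
  zero : ∀ i, i < 0 ∨ n < i → u i = 0
  le_shift : ∀ i j, i + j = n - 1 → u i * u j ≤ u (i + 1) * u (j + 1)
  shift_le : ∀ i j, i + j = n → u (i + 1) * u (j + 1) ≤ u i * u j

namespace RatioSpiral

variable {n : ℤ} {u : ℤ → ℝ}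

theorem nonneg (h : RatioSpiral n u) (i : ℤ) : 0 ≤ u i := by
  by_cases hi : 0 ≤ i ∧ i ≤ n
  · exact (h.pos i hi.1 hi.2).le
  · exact (h.zero i (by omega)).ge

theorem pred_mul_pred_le (h : RatioSpiral n u) {i j : ℤ} (hij : i + j = n) :
    u (i - 1) * u (j - 1) ≤ u (i + 1) * u (j + 1) := by
  have hr : 0 ≤ u (i + 1) * u (j + 1) := mul_nonneg (h.nonneg _) (h.nonneg _)
  by_cases hi : i < 1
  · rw [h.zero (i - 1) (by omega), zero_mul]; exact hr
  by_cases hj : j < 1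
  · rw [h.zero (j - 1) (by omega), mul_zero]; exact hr
  have hui := h.pos i (by omega) (by omega)
  have huj := h.pos j (by omega) (by omega)
  have e1 := h.le_shift (i - 1) j (by omega)
  have e2 := h.le_shift i (j - 1) (by omega)
  rw [sub_add_cancel] at e1 e2
  have e3 := mul_le_mul e1 e2 (mul_nonneg (h.nonneg _) (h.nonneg _))
    (mul_nonneg (h.nonneg _) (h.nonneg _))
  refine le_of_mul_le_mul_right ?_ (mul_pos hui huj)
  linarith

theorem succ_mul_succ_le (h : RatioSpiral n u) {i j : ℤ} (hij : i + j = n + 1) :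
    u (i + 1) * u (j + 1) ≤ u (i - 1) * u (j - 1) := by
  have hr : 0 ≤ u (i - 1) * u (j - 1) := mul_nonneg (h.nonneg _) (h.nonneg _)
  by_cases hi : n < i + 1
  · rw [h.zero (i + 1) (by omega), zero_mul]; exact hr
  by_cases hj : n < j + 1
  · rw [h.zero (j + 1) (by omega), mul_zero]; exact hr
  have hui := h.pos i (by omega) (by omega)
  have huj := h.pos j (by omega) (by omega)
  have e1 := h.shift_le (i - 1) j (by omega)
  have e2 := h.shift_le i (j - 1) (by omega)
  rw [sub_add_cancel] at e1 e2
  have e3 := mul_le_mul e1 e2 (mul_nonneg (h.nonneg _) (h.nonneg _))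
    (mul_nonneg (h.nonneg _) (h.nonneg _))
  refine le_of_mul_le_mul_right ?_ (mul_pos hui huj)
  linarith

theorem le_shift_step (h : RatioSpiral n u) {p q s : ℝ} (hp : 0 < p) (hq : 0 < q) (hps : p ≤ s)
    {u' : ℤ → ℝ}
    (hu' : ∀ k : ℤ, u' k = (p + q * k) * u k + (q * (n + 1 - k) + s) * u (k - 1))
    {i j : ℤ} (hi : 0 ≤ i) (hj : 0 ≤ j) (hij : i + j = n) :
    u' i * u' j ≤ u' (i + 1) * u' (j + 1) := by
  have c1 := h.pred_mul_pred_le hij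
  have c2 := c1.trans (h.shift_le i j hij)
  have c3 := h.le_shift (i - 1) j (by omega)
  have c4 := h.le_shift i (j - 1) (by omega)
  rw [sub_add_cancel] at c3 c4
  have c5 : 2 * (u (i - 1) * u (j - 1)) ≤ u i * u (j + 1) + u (i + 1) * u j :=
    two_mul_le_add_of_le (mul_nonneg (h.nonneg _) (h.nonneg _))
      (mul_nonneg (h.nonneg _) (h.nonneg _)) (mul_nonneg (h.nonneg _) (h.nonneg _)) c1 c2 (by ring)
  have hi' : (0 : ℝ) ≤ q * i := mul_nonneg hq.le (by exact_mod_cast hi)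
  have hj' : (0 : ℝ) ≤ q * j := mul_nonneg hq.le (by exact_mod_cast hj)
  have hn : (n : ℝ) = i + j := by exact_mod_cast hij.symm
  simp only [hu', add_sub_cancel_right, hn]
  push_cast
  have d1 := mul_le_mul_of_nonneg_left c1
    (show 0 ≤ (q * i + q + p) * (q * j + q + p) by positivity)
  have d2 := mul_le_mul_of_nonneg_left c2
    (show 0 ≤ (s - p) * (q * i + q * j + s + p) from
      mul_nonneg (by linarith) (by linarith))
  have d3 := mul_le_mul_of_nonneg_left c3
    (show 0 ≤ (q * j + q + s) * (q * j + p) from mul_nonneg (by linarith) (by linarith))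
  have d4 := mul_le_mul_of_nonneg_left c4
    (show 0 ≤ (q * i + q + s) * (q * i + p) from mul_nonneg (by linarith) (by linarith))
  have d5 := mul_le_mul_of_nonneg_left c5
    (show 0 ≤ q * (s - p) from mul_nonneg hq.le (by linarith))
  linear_combination d1 + d2 + d3 + d4 + d5

theorem shift_le_step (h : RatioSpiral n u) {p q s : ℝ} (hp : 0 < p) (hps : p ≤ s)
    (hq : 0 < q) (hspq : s ≤ p + q) {u' : ℤ → ℝ}
    (hu' : ∀ k : ℤ, u' k = (p + q * k) * u k + (q * (n + 1 - k) + s) * u (k - 1))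
    {i j : ℤ} (hi : 1 ≤ i) (hj : 1 ≤ j) (hij : i + j = n + 1) :
    u' (i + 1) * u' (j + 1) ≤ u' i * u' j := by
  have c1 := h.succ_mul_succ_le hij
  have c2 := c1.trans (h.le_shift (i - 1) (j - 1) (by omega))
  have c3 := h.shift_le (i - 1) j (by omega)
  have c4 := h.shift_le i (j - 1) (by omega)
  simp only [sub_add_cancel] at c2 c3 c4
  have c5 : 2 * (u (i + 1) * u (j + 1)) ≤ u i * u (j - 1) + u (i - 1) * u j :=
    two_mul_le_add_of_le (mul_nonneg (h.nonneg _) (h.nonneg _))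
      (mul_nonneg (h.nonneg _) (h.nonneg _)) (mul_nonneg (h.nonneg _) (h.nonneg _)) c1 c2 (by ring)
  have hi' : q ≤ q * i := le_mul_of_one_le_right hq.le (by exact_mod_cast hi)
  have hj' : q ≤ q * j := le_mul_of_one_le_right hq.le (by exact_mod_cast hj)
  have hn : (n : ℝ) = i + j - 1 := by
    rw [eq_sub_iff_add_eq]; exact_mod_cast hij.symm
  simp only [hu', add_sub_cancel_right, hn]
  push_cast
  have d1 := mul_le_mul_of_nonneg_left c1
    (show 0 ≤ (q * i + s) * (q * j + s) from mul_nonneg (by linarith) (by linarith))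
  have d2 := mul_le_mul_of_nonneg_left c2
    (show 0 ≤ (p + q - s) * (q * i + q * j + s + p - q) from
      mul_nonneg (by linarith) (by linarith))
  have d3 := mul_le_mul_of_nonneg_left c3
    (show 0 ≤ (q * j + q + p) * (q * j - q + s) from mul_nonneg (by linarith) (by linarith))
  have d4 := mul_le_mul_of_nonneg_left c4
    (show 0 ≤ (q * i + q + p) * (q * i - q + s) from mul_nonneg (by linarith) (by linarith))
  have d5 := mul_le_mul_of_nonneg_left c5
    (show 0 ≤ q * (p + q - s) from mul_nonneg hq.le (by linarith))
  linear_combination d1 + d2 + d3 + d4 + d5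

theorem step (h : RatioSpiral n u) (hn : 0 ≤ n) {p q s : ℝ} (hp : 0 < p) (hq : 0 < q)
    (hps : p ≤ s) (hspq : s ≤ p + q) {u' : ℤ → ℝ}
    (hu' : ∀ k : ℤ, u' k = (p + q * k) * u k + (q * (n + 1 - k) + s) * u (k - 1)) :
    RatioSpiral (n + 1) u' := by
  have hzero : ∀ i, i < 0 ∨ n + 1 < i → u' i = 0 := fun i hi => by
    rw [hu', h.zero i (by omega), h.zero (i - 1) (by omega), mul_zero, mul_zero, add_zero]
  have hpos : ∀ i, 0 ≤ i → i ≤ n + 1 → 0 < u' i := fun i hi hin => by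
    have hi' : (0 : ℝ) ≤ i := by exact_mod_cast hi
    have hin' : (0 : ℝ) ≤ n + 1 - i := by
      rw [sub_nonneg]; exact_mod_cast hin
    have h1 : 0 < p + q * i := by positivity
    have h2 : 0 < q * (n + 1 - i) + s := add_pos_of_nonneg_of_pos (by positivity) (by linarith)
    rw [hu']
    rcases hin.lt_or_eq with hlt | heq
    · exact add_pos_of_pos_of_nonneg (mul_pos h1 (h.pos i hi (by omega)))
        (mul_nonneg h2.le (h.nonneg _))
    · exact add_pos_of_nonneg_of_pos (mul_nonneg h1.le (h.nonneg _))
        (mul_pos h2 (h.pos _ (by omega) (by omega)))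
  have hnn : ∀ i, 0 ≤ u' i := fun i => by
    by_cases hi : 0 ≤ i ∧ i ≤ n + 1
    · exact (hpos i hi.1 hi.2).le
    · exact (hzero i (by omega)).ge
  refine ⟨hpos, hzero, fun i j hij => ?_, fun i j hij => ?_⟩
  · by_cases hi : i < 0
    · rw [hzero i (.inl hi), zero_mul]; exact mul_nonneg (hnn _) (hnn _)
    by_cases hj : j < 0
    · rw [hzero j (.inl hj), mul_zero]; exact mul_nonneg (hnn _) (hnn _)
    exact h.le_shift_step hp hq hps hu' (by omega) (by omega) (by omega)
  · by_cases hi : i < 1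
    · rw [hzero (j + 1) (by omega), mul_zero]; exact mul_nonneg (hnn _) (hnn _)
    by_cases hj : j < 1
    · rw [hzero (i + 1) (by omega), zero_mul]; exact mul_nonneg (hnn _) (hnn _)
    exact h.shift_le_step hp hps hq hspq hu' (by omega) (by omega) (by omega)

end RatioSpiral

/-- The coefficients of `f`, extended by zero to negative indices. -/
noncomputable def intCoeff (f : ℝ[X]) (k : ℤ) : ℝ := if 0 ≤ k then f.coeff k.toNat else 0

theorem intCoeff_natCast (f : ℝ[X]) (k : ℕ) : intCoeff f k = f.coeff k := by
  simp [intCoeff]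

theorem intCoeff_of_neg (f : ℝ[X]) {k : ℤ} (hk : k < 0) : intCoeff f k = 0 := by
  simp [intCoeff, hk]

theorem ratioSpiral_intCoeff_one : RatioSpiral 0 (intCoeff 1) := by
  have h : ∀ k : ℤ, k ≠ 0 → intCoeff 1 k = 0 := fun k hk => by
    rcases lt_or_ge k 0 with h | h
    · exact intCoeff_of_neg _ h
    · lift k to ℕ using h
      rw [intCoeff_natCast, coeff_one, if_neg (by exact_mod_cast hk)]
  refine ⟨fun i hi hi' => ?_, fun i hi => h i (by omega), fun i j hij => ?_, fun i j hij => ?_⟩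
  · obtain rfl : i = 0 := le_antisymm hi' hi
    simp [intCoeff]
  · have h0 : intCoeff 1 i * intCoeff 1 j = 0 := by
      rcases eq_or_ne i 0 with rfl | hi
      · rw [h j (by omega), mul_zero]
      · rw [h i hi, zero_mul]
    rw [h0]
    rcases eq_or_ne (i + 1) 0 with hi | hi
    · rw [h (j + 1) (by omega), mul_zero]
    · rw [h (i + 1) hi, zero_mul]
  · have h0 : intCoeff 1 (i + 1) * intCoeff 1 (j + 1) = 0 := by
      rcases eq_or_ne (i + 1) 0 with hi | hi
      · rw [h (j + 1) (by omega), mul_zero]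
      · rw [h (i + 1) hi, zero_mul]
    rw [h0]
    rcases eq_or_ne i 0 with rfl | hi
    · obtain rfl : j = 0 := by omega
      exact mul_self_nonneg _
    · rw [h i hi, zero_mul]

theorem intCoeff_step (f : ℝ[X]) (n p q s : ℝ) (k : ℤ) :
    intCoeff ((C (q * n + s) * X + C p) * f + C q * X * (1 - X) * derivative f) k =
      (p + q * k) * intCoeff f k + (q * (n + 1 - k) + s) * intCoeff f (k - 1) := by
  rcases lt_or_ge k 0 with h | h
  · simp [intCoeff_of_neg, h, (by omega : k - 1 < 0)]
  lift k to ℕ using h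
  have e : (C (q * n + s) * X + C p) * f + C q * X * (1 - X) * derivative f =
      C (q * n + s) * (X * f) + C p * f + C q * (X * derivative f) -
        C q * (X * (X * derivative f)) := by ring
  rw [e]
  rcases k with _ | _ | k
  · simp [intCoeff]
  · have : ((0 + 1 : ℕ) : ℤ) - 1 = (0 : ℕ) := by simp
    rw [this, intCoeff_natCast, intCoeff_natCast, intCoeff_natCast]
    simp only [coeff_sub, coeff_add, coeff_C_mul, coeff_X_mul, coeff_X_mul_zero,
      coeff_derivative]
    push_cast
    ring
  · have : ((k + 1 + 1 : ℕ) : ℤ) - 1 = (k + 1 : ℕ) := by push_cast; ring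
    rw [this, intCoeff_natCast, intCoeff_natCast, intCoeff_natCast]
    simp only [coeff_sub, coeff_add, coeff_C_mul, coeff_X_mul, coeff_derivative]
    push_cast
    ring

theorem RatioSpiral.natDegree_eq {n : ℕ} {f : ℝ[X]} (h : RatioSpiral n (intCoeff f)) :
    f.natDegree = n := by
  refine natDegree_eq_of_le_of_coeff_ne_zero ?_ ?_
  · refine natDegree_le_iff_coeff_eq_zero.2 fun k hk => ?_
    rw [← intCoeff_natCast]
    exact h.zero _ (by omega)
  · rw [← intCoeff_natCast]
    exact (h.pos _ (by omega) le_rfl).ne'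

theorem RatioSpiral.ratioMonotone_reflect {n : ℕ} (hn : 1 ≤ n) {f : ℝ[X]}
    (h : RatioSpiral n (intCoeff f)) : RatioMonotone (reflect n f) := by
  have hc : ∀ i ≤ n, (reflect n f).coeff i = intCoeff f (n - i) := fun i hi => by
    rw [coeff_reflect, revAt_le hi, ← intCoeff_natCast, Nat.cast_sub hi]
  have hpos : ∀ i ≤ n, 0 < (reflect n f).coeff i := fun i hi => by
    rw [hc i hi]; exact h.pos _ (by omega) (by omega)
  have hdeg : (reflect n f).natDegree = n := by
    refine natDegree_eq_of_le_of_coeff_ne_zero ?_ (hpos n le_rfl).ne'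
    refine natDegree_le_iff_coeff_eq_zero.2 fun k hk => ?_
    rw [coeff_reflect, revAt_eq_self_of_lt hk, ← intCoeff_natCast]
    exact h.zero _ (by omega)
  have hA : ∀ i j : ℕ, i + j = n + 1 → 1 ≤ i → 1 ≤ j →
      (reflect n f).coeff i * (reflect n f).coeff j ≤
        (reflect n f).coeff (i - 1) * (reflect n f).coeff (j - 1) := fun i j hij hi hj => by
    rw [hc i (by omega), hc j (by omega), hc (i - 1) (by omega), hc (j - 1) (by omega)]
    convert h.le_shift (n - i) (n - j) (by omega) using 3 <;> omega
  have hB : ∀ i j : ℕ, i + j = n → 1 ≤ i → 1 ≤ j →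
      (reflect n f).coeff (i - 1) * (reflect n f).coeff (j - 1) ≤
        (reflect n f).coeff i * (reflect n f).coeff j := fun i j hij hi hj => by
    rw [hc i (by omega), hc j (by omega), hc (i - 1) (by omega), hc (j - 1) (by omega)]
    convert h.shift_le (n - i) (n - j) (by omega) using 3 <;> omega
  rw [RatioMonotone, hdeg]
  refine ⟨hpos, fun i hi => ?_, ?_, fun i hi => ?_, fun hn2 => ?_⟩
  · rw [div_le_div_iff₀ (hpos _ (by omega)) (hpos _ (by omega))]
    have := hA (n - i) (i + 1) (by omega) (by omega) (by omega)
    rw [Nat.add_sub_cancel, Nat.sub_sub] at this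
    exact this
  · rw [div_le_one (hpos _ (by omega))]
    obtain ⟨m, rfl | rfl⟩ : ∃ m, n = 2 * m + 1 ∨ n = 2 * m + 2 := ⟨(n - 1) / 2, by omega⟩
    · have := hA (m + 1) (m + 1) (by omega) (by omega) (by omega)
      rw [(by omega : 2 * m + 1 - (2 * m + 1 - 1) / 2 = m + 1),
        (by omega : (2 * m + 1 - 1) / 2 = m)]
      rw [Nat.add_sub_cancel] at this
      exact (mul_self_le_mul_self_iff (hpos _ (by omega)).le (hpos _ (by omega)).le).2 this
    · have := hA (m + 2) (m + 1) (by omega) (by omega) (by omega)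
      rw [(by omega : 2 * m + 2 - (2 * m + 2 - 1) / 2 = m + 2),
        (by omega : (2 * m + 2 - 1) / 2 = m)]
      rw [Nat.add_sub_cancel, (by omega : m + 2 - 1 = m + 1),
        mul_comm (coeff _ (m + 1))] at this
      exact le_of_mul_le_mul_right this (hpos _ (by omega))
  · rw [div_le_div_iff₀ (hpos _ (by omega)) (hpos _ (by omega))]
    have := hB (i + 1) (n - 1 - i) (by omega) (by omega) (by omega)
    rw [Nat.add_sub_cancel, Nat.sub_sub _ i] at this
    exact this
  · rw [div_le_one (hpos _ (by omega))]
    obtain ⟨m, rfl | rfl⟩ : ∃ m, n = 2 * m ∨ n = 2 * m + 1 := ⟨n / 2, by omega⟩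
    · have := hB m m (by omega) (by omega) (by omega)
      rw [(by omega : 2 * m - 2 * m / 2 = m), (by omega : 2 * m / 2 = m)]
      exact (mul_self_le_mul_self_iff (hpos _ (by omega)).le (hpos _ (by omega)).le).2 this
    · have := hB m (m + 1) (by omega) (by omega) (by omega)
      rw [(by omega : 2 * m + 1 - (2 * m + 1) / 2 = m + 1),
        (by omega : (2 * m + 1) / 2 = m)]
      rw [Nat.add_sub_cancel, mul_comm (coeff _ m)] at this
      exact le_of_mul_le_mul_right this (hpos _ (by omega))

/-- Gamma-positivity with respect to a prescribed centre of symmetry `m / 2`. -/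
def GammaCone (m : ℕ) (f : ℝ[X]) : Prop :=
  ∃ γ : ℕ → ℝ, (∀ k, 0 ≤ γ k) ∧
    f = ∑ k ∈ Finset.range (m / 2 + 1), C (γ k) * X ^ k * (1 + X) ^ (m - 2 * k)

namespace GammaCone

variable {m : ℕ} {f g : ℝ[X]}

theorem zero (m : ℕ) : GammaCone m 0 := ⟨fun _ => 0, fun _ => le_rfl, by simp⟩

theorem add (hf : GammaCone m f) (hg : GammaCone m g) : GammaCone m (f + g) := by
  obtain ⟨γ, hγ, rfl⟩ := hf
  obtain ⟨δ, hδ, rfl⟩ := hg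
  refine ⟨fun k => γ k + δ k, fun k => add_nonneg (hγ k) (hδ k), ?_⟩
  rw [← Finset.sum_add_distrib]
  exact Finset.sum_congr rfl fun k _ => by rw [C_add]; ring

theorem C_mul (hf : GammaCone m f) {c : ℝ} (hc : 0 ≤ c) : GammaCone m (C c * f) := by
  obtain ⟨γ, hγ, rfl⟩ := hf
  refine ⟨fun k => c * γ k, fun k => mul_nonneg hc (hγ k), ?_⟩
  rw [Finset.mul_sum]
  exact Finset.sum_congr rfl fun k _ => by rw [Polynomial.C_mul]; ring

theorem basis (k l : ℕ) : GammaCone (2 * k + l) (X ^ k * (1 + X) ^ l) := by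
  refine ⟨fun i => if i = k then 1 else 0, fun i => by dsimp only; split_ifs <;> norm_num, ?_⟩
  rw [Finset.sum_eq_single k]
  · simp
  · intro i _ hi
    simp [hi]
  · intro h
    exact absurd (Finset.mem_range.2 (by omega)) h

/-- To transport a gamma expansion along an additive homogeneous map, it suffices to look at the
gamma basis. -/
theorem induction (hf : GammaCone m f) {Q : ℝ[X] → Prop} (h0 : Q 0)
    (hadd : ∀ f g, Q f → Q g → Q (f + g)) (hC : ∀ c f, 0 ≤ c → Q f → Q (C c * f))
    (hbasis : ∀ k l, 2 * k + l = m → Q (X ^ k * (1 + X) ^ l)) : Q f := by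
  obtain ⟨γ, hγ, rfl⟩ := hf
  refine Finset.sum_induction _ Q hadd h0 fun k hk => ?_
  rw [mul_assoc]
  exact hC _ _ (hγ k) (hbasis _ _ (by have := Finset.mem_range.1 hk; omega))

theorem one_add_X_mul (hf : GammaCone m f) : GammaCone (m + 1) ((1 + X) * f) := by
  refine hf.induction (Q := fun f => GammaCone (m + 1) ((1 + X) * f)) ?_ ?_ ?_ ?_
  · rw [mul_zero]; exact zero _
  · intro f g hf hg; rw [mul_add]; exact hf.add hg
  · intro c f hc hf; rw [mul_left_comm]; exact hf.C_mul hc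
  · rintro k l rfl
    convert basis k (l + 1) using 1 <;> ring

theorem X_mul (hf : GammaCone m f) : GammaCone (m + 2) (X * f) := by
  refine hf.induction (Q := fun f => GammaCone (m + 2) (X * f)) ?_ ?_ ?_ ?_
  · rw [mul_zero]; exact zero _
  · intro f g hf hg; rw [mul_add]; exact hf.add hg
  · intro c f hc hf; rw [mul_left_comm]; exact hf.C_mul hc
  · rintro k l rfl
    convert basis (k + 1) l using 1 <;> ring

theorem eulerian (hf : GammaCone m f) :
    GammaCone (m + 1) (C (m : ℝ) * X * f + X * (1 - X) * derivative f) := by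
  refine hf.induction
    (Q := fun f => GammaCone (m + 1) (C (m : ℝ) * X * f + X * (1 - X) * derivative f)) ?_ ?_ ?_ ?_
  · rw [mul_zero, derivative_zero, mul_zero, add_zero]; exact zero _
  · intro f g hf hg
    convert hf.add hg using 1
    rw [derivative_add]; ring
  · intro c f hc hf
    convert hf.C_mul hc using 1
    rw [derivative_C_mul]; ring
  · rintro k l rfl
    have hk : X * derivative (X ^ k : ℝ[X]) = C (k : ℝ) * X ^ k := by
      rcases k with _ | k
      · simp
      · rw [derivative_X_pow, Nat.add_sub_cancel]; ring
    rcases l with _ | l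
    · convert (basis k 1).C_mul (Nat.cast_nonneg (α := ℝ) k) using 1
      simp only [add_zero, pow_zero, mul_one, pow_one, Nat.cast_mul, Polynomial.C_mul]
      simp only [Nat.cast_ofNat, map_ofNat]
      linear_combination (1 - X) * hk
    · have e1 : GammaCone (2 * k + (l + 1) + 1) _ :=
        (basis k (l + 2)).C_mul (Nat.cast_nonneg (α := ℝ) k)
      have e2 := (basis (k + 1) l).C_mul
        (mul_nonneg zero_le_two (Nat.cast_nonneg (α := ℝ) (l + 1)))
      rw [(by ring : 2 * (k + 1) + l = 2 * k + (l + 1) + 1)] at e2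
      convert e1.add e2 using 1
      have hl : derivative ((1 + X : ℝ[X]) ^ (l + 1)) = C ((l + 1 : ℕ) : ℝ) * (1 + X) ^ l := by
        rw [derivative_pow]; simp
      have h : X * (1 - X) * derivative (X ^ k * (1 + X) ^ (l + 1) : ℝ[X]) =
          (1 - X) * (C (k : ℝ) * X ^ k) * (1 + X) ^ (l + 1) +
            X * (1 - X) * X ^ k * (C ((l + 1 : ℕ) : ℝ) * (1 + X) ^ l) := by
        rw [derivative_mul, hl, ← hk]; ring
      rw [h]
      push_cast
      simp only [C_add, Polynomial.C_mul, C_1, map_ofNat]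
      ring

theorem reflect_one_add_X_pow (l : ℕ) : reflect l ((1 + X : ℝ[X]) ^ l) = (1 + X) ^ l := by
  ext i
  rw [coeff_reflect, coeff_one_add_X_pow, coeff_one_add_X_pow]
  rcases le_or_gt i l with h | h
  · rw [revAt_le h, Nat.choose_symm h]
  · rw [revAt_eq_self_of_lt h]

theorem reflect_eq (hf : GammaCone m f) : reflect m f = f := by
  refine hf.induction (Q := fun f => reflect m f = f) ?_ ?_ ?_ ?_
  · simp
  · intro f g hf hg; rw [reflect_add, hf, hg]
  · intro c f _ hf; rw [reflect_C_mul, hf]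
  · rintro k l rfl
    have hl : ((1 + X : ℝ[X]) ^ l).natDegree ≤ l := by compute_degree
    rw [reflect_mul _ _ (by rw [natDegree_X_pow]; omega) hl, reflect_one_add_X_pow,
      reflect_monomial, revAt_le (by omega), two_mul, Nat.add_sub_cancel]

theorem natDegree_le (hf : GammaCone m f) : f.natDegree ≤ m := by
  refine hf.induction (Q := fun f => f.natDegree ≤ m) ?_ ?_ ?_ ?_
  · simp
  · intro f g hf hg; exact natDegree_add_le_of_degree_le hf hg
  · intro c f _ hf; exact (natDegree_C_mul_le _ _).trans hf
  · rintro k l rfl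
    compute_degree
    omega

theorem gammaPositive (hf : GammaCone m f) (h : f = 0 ∨ f.coeff 0 ≠ 0) : GammaPositive f := by
  rcases h with rfl | h
  · exact zero _
  · have hd : f.natDegree = m := by
      refine natDegree_eq_of_le_of_coeff_ne_zero hf.natDegree_le ?_
      rwa [← hf.reflect_eq, coeff_reflect, revAt_le le_rfl, Nat.sub_self]
    rw [GammaPositive, hd]
    exact hf

end GammaCone

/-- If `f = a + X b` with `a`, `b` symmetric of degree `m + 1` and `m`, then `(a, b)` is the
symmetric decomposition of `f`. -/
theorem GammaCone.biGammaPositive {m : ℕ} {f a b : ℝ[X]} (hdeg : f.natDegree = m + 1)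
    (ha : GammaCone (m + 1) a) (hb : GammaCone m b) (hf : f = a + X * b)
    (ha0 : a.coeff 0 ≠ 0) (hb0 : b = 0 ∨ b.coeff 0 ≠ 0) : BiGammaPositive f := by
  have hr : reflect f.natDegree f = a + b := by
    have hX : reflect 1 (X : ℝ[X]) = 1 := by
      rw [← pow_one (X : ℝ[X]), reflect_monomial, revAt_le le_rfl, Nat.sub_self, pow_zero]
    rw [hdeg, hf, reflect_add, ha.reflect_eq, add_comm m 1,
      reflect_mul _ _ natDegree_X_le hb.natDegree_le, hb.reflect_eq, hX, one_mul]
  refine ⟨a, b, ?_, ?_, ha.gammaPositive (.inr ha0), hb.gammaPositive hb0⟩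
  · rw [hr, hf]; ring
  · rw [hr, hf]; ring

theorem exists_gammaCone_decomposition {p q s : ℝ} (hp : 0 < p) (hq : 0 < q) (hps : p ≤ s)
    (hspq : s ≤ p + q) {P : ℕ → ℝ[X]} (hP0 : P 0 = 1)
    (hrec : ∀ n : ℕ, P (n + 1) = (C (q * n + s) * X + C p) * P n +
      C q * X * (1 - X) * derivative (P n)) (n : ℕ) :
    ∃ a b : ℝ[X], P (n + 1) = a + X * b ∧ GammaCone (n + 1) a ∧ GammaCone n b ∧
      0 < a.coeff 0 ∧ (s = p ∧ b = 0 ∨ 0 < b.coeff 0) := by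
  induction n with
  | zero =>
    refine ⟨C p * (1 + X), C (s - p), ?_, ?_, ?_, ?_, ?_⟩
    · rw [hrec, hP0]
      simp
      ring
    · simpa using (GammaCone.basis 0 1).C_mul hp.le
    · simpa using (GammaCone.basis 0 0).C_mul (sub_nonneg.2 hps)
    · simpa using hp
    · rcases hps.eq_or_lt with h | h
      · exact .inl ⟨h.symm, by simp [h]⟩
      · exact .inr (by simpa using h)
  | succ n ih =>
    obtain ⟨a, b, hP, ha, hb, ha0, hb0⟩ := ih
    refine ⟨C q * (C ((n + 1 : ℕ) : ℝ) * X * a + X * (1 - X) * derivative a) +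
        C p * ((1 + X) * a) + C (p + q - s) * (X * b),
      C (s - p) * a + C q * (C (n : ℝ) * X * b + X * (1 - X) * derivative b) +
        C s * ((1 + X) * b), ?_, ?_, ?_, ?_, ?_⟩
    · rw [hrec, hP]
      simp only [derivative_add, derivative_mul, derivative_X, C_add, C_sub, Polynomial.C_mul]
      push_cast
      simp only [C_add, C_1]
      ring
    · exact ((ha.eulerian.C_mul hq.le).add (ha.one_add_X_mul.C_mul hp.le)).add
        (hb.X_mul.C_mul (by linarith))
    · exact ((ha.C_mul (sub_nonneg.2 hps)).add (hb.eulerian.C_mul hq.le)).add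
        (hb.one_add_X_mul.C_mul (hp.le.trans hps))
    · simpa [mul_coeff_zero] using mul_pos hp ha0
    · rcases hb0 with ⟨h, rfl⟩ | h
      · exact .inl ⟨h, by simp [h]⟩
      · refine .inr ?_
        have := mul_nonneg (sub_nonneg.2 hps) ha0.le
        have := mul_pos (hp.trans_le hps) h
        simp [mul_coeff_zero]
        linarith

theorem ratioSpiral_intCoeff_of_rec {p q s : ℝ} (hp : 0 < p) (hq : 0 < q) (hps : p ≤ s)
    (hspq : s ≤ p + q) {P : ℕ → ℝ[X]} (hP0 : P 0 = 1)
    (hrec : ∀ n : ℕ, P (n + 1) = (C (q * n + s) * X + C p) * P n +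
      C q * X * (1 - X) * derivative (P n)) (n : ℕ) :
    RatioSpiral n (intCoeff (P n)) := by
  induction n with
  | zero => rw [hP0]; exact_mod_cast ratioSpiral_intCoeff_one
  | succ n ih =>
    rw [Nat.cast_succ]
    refine ih.step (Int.natCast_nonneg n) hp hq hps hspq fun k => ?_
    rw [hrec, intCoeff_step, Int.cast_natCast]

/-- for positive integers `p, q, r` with `q + 2p ≥ q r ≥ 2p > 0`,
the polynomials defined by
`P (n+1) = (q n X + (q r − p) X + p) P n + q X (1 − X) (P n)'`, `P 0 = 1`,
have degree `n`, are bi-gamma-positive, and their reciprocals are ratio monotone. -/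
theorem stmt4 (p q r : ℕ) (hp : 0 < p) (hq : 0 < q) (hr : 0 < r)
    (h1 : q * r ≤ q + 2 * p) (h2 : 2 * p ≤ q * r)
    (P : ℕ → Polynomial ℝ) (hP0 : P 0 = 1)
    (hrec : ∀ n : ℕ, P (n + 1) =
      (Polynomial.C ((q : ℝ) * n + ((q : ℝ) * r - (p : ℝ))) * Polynomial.X +
          Polynomial.C (p : ℝ)) * P n +
        Polynomial.C (q : ℝ) * Polynomial.X * (1 - Polynomial.X) *
          Polynomial.derivative (P n)) :
    ∀ n : ℕ, 1 ≤ n → (P n).natDegree = n ∧ BiGammaPositive (P n) ∧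
      RatioMonotone (Polynomial.reflect n (P n)) := by
  have hp' : (0 : ℝ) < p := by exact_mod_cast hp
  have hq' : (0 : ℝ) < q := by exact_mod_cast hq
  have h1' : (q : ℝ) * r ≤ q + 2 * p := by exact_mod_cast h1
  have h2' : 2 * (p : ℝ) ≤ q * r := by exact_mod_cast h2
  have hps : (p : ℝ) ≤ q * r - p := by linarith
  have hspq : (q : ℝ) * r - p ≤ p + q := by linarith
  intro n hn
  have hS := ratioSpiral_intCoeff_of_rec hp' hq' hps hspq hP0 hrec n
  refine ⟨hS.natDegree_eq, ?_, hS.ratioMonotone_reflect hn⟩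
  obtain ⟨m, rfl⟩ : ∃ m, n = m + 1 := ⟨n - 1, by omega⟩
  obtain ⟨a, b, hP, ha, hb, ha0, hb0⟩ :=
    exists_gammaCone_decomposition hp' hq' hps hspq hP0 hrec m
  exact GammaCone.biGammaPositive hS.natDegree_eq ha hb hP ha0.ne'
    (hb0.imp And.right ne_of_gt)
end

section
/- Let p, q, r be positive integers with q(1 + r) ≥ 2p ≥ q r > p > 0, and let (P_n(x))_{n≥0} be real polynomials with P_0(x) = 1 satisfying P_{n+1}(x) = (q n x + (q r − p) x + p) P_n(x) + q x (1 − x) P_n'(x) for all n ≥ 0. Then for every n ≥ 1 the polynomial P_n(x) has degree n and is ratio monotone. -/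
open Polynomial

/-- `g` is supported on `1, …, n + 1`, positive there, and satisfies the cross-multiplied
inequalities equivalent to ratio monotonicity of the sequence `k ↦ g (k + 1)`. -/
structure CrossMonotone (n : ℕ) (g : ℕ → ℝ) : Prop where
  zero : g 0 = 0
  pos : ∀ k ≤ n, 0 < g (k + 1)
  eq_zero : ∀ k, n + 1 < k → g k = 0
  upper : ∀ i j, i + j = n + 1 → g (i + 1) * g (j + 1) ≤ g i * g j
  lower : ∀ i j, i + j = n → g i * g j ≤ g (i + 1) * g (j + 1)

lemma CrossMonotone.nonneg {n : ℕ} {g : ℕ → ℝ} (h : CrossMonotone n g) (k : ℕ) : 0 ≤ g k := by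
  rcases k with _ | k
  · exact h.zero.ge
  · rcases le_or_gt k n with hk | hk
    · exact (h.pos k hk).le
    · exact (h.eq_zero _ (by omega)).ge

lemma cross_mul_le {q δ α β x₀ x₁ x₂ y₀ y₁ y₂ : ℝ} (hq : 0 ≤ q) (hδ : 0 ≤ δ)
    (hα : δ ≤ α) (hβ : δ ≤ β) (hx₀ : 0 ≤ x₀) (hx₁ : 0 < x₁)
    (hy₀ : 0 ≤ y₀) (hy₁ : 0 < y₁) (hy₂ : 0 ≤ y₂)
    (hxy : x₂ * y₁ ≤ x₁ * y₀) (hyx : x₁ * y₂ ≤ x₀ * y₁) (h : x₀ * y₀ ≤ x₁ * y₁) :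
    ((α + q) * x₂ + (β - δ) * x₁) * ((β + q) * y₂ + (α - δ) * y₁) ≤
      (α * x₁ + (β + q - δ) * x₀) * (β * y₁ + (α + q - δ) * y₀) := by
  have outer : x₂ * y₂ ≤ x₀ * y₀ := by
    have := mul_le_mul hxy hyx (by positivity) (by positivity)
    refine le_of_mul_le_mul_right (a := x₁ * y₁) ?_ (by positivity)
    linarith
  have amgm : 2 * (x₀ * y₀) ≤ x₁ * y₀ + x₀ * y₁ := by
    refine abs_le_of_sq_le_sq' ?_ (by positivity) |>.2
    have := mul_le_mul_of_nonneg_left h (mul_nonneg hx₀ hy₀)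
    nlinarith [sq_nonneg (x₁ * y₀ - x₀ * y₁)]
  have hα' : 0 ≤ α := hδ.trans hα
  have hβ' : 0 ≤ β := hδ.trans hβ
  have e₁ := mul_le_mul_of_nonneg_left hxy
    (mul_nonneg (by linarith : 0 ≤ α + q) (sub_nonneg.2 hα))
  have e₂ := mul_le_mul_of_nonneg_left hyx
    (mul_nonneg (by linarith : 0 ≤ β + q) (sub_nonneg.2 hβ))
  have e₃ := mul_le_mul_of_nonneg_left outer
    (mul_nonneg (by linarith : 0 ≤ α + q) (by linarith : 0 ≤ β + q))
  have e₄ := mul_le_mul_of_nonneg_left h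
    (mul_nonneg hδ (by linarith : 0 ≤ α + β - δ))
  have e₅ := mul_le_mul_of_nonneg_left amgm (mul_nonneg hq hδ)
  linarith

lemma CrossMonotone.succ {n : ℕ} {g G : ℕ → ℝ} (h : CrossMonotone n g) {q a b : ℝ}
    (hq : 0 ≤ q) (ha : 0 < a) (hb : 0 < b) (hba : b ≤ a) (hab : a ≤ b + q) (hG₀ : G 0 = 0)
    (hG : ∀ k : ℕ, G (k + 1) = (a + q * k) * g (k + 1) + (b + q * (n + 1 - k)) * g k) :
    CrossMonotone (n + 1) G := by
  have pos : ∀ k ≤ n + 1, 0 < G (k + 1) := by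
    intro k hk
    rw [hG]
    have hc : (k : ℝ) ≤ n + 1 := by exact_mod_cast hk
    have hb' : 0 < b + q * (n + 1 - k) := by
      have := mul_nonneg hq (sub_nonneg.2 hc)
      linarith
    have ha' : 0 < a + q * k := by positivity
    rcases k with _ | k
    · have := h.pos 0 n.zero_le
      rw [h.zero]
      simpa using mul_pos ha this
    · exact add_pos_of_nonneg_of_pos (mul_nonneg ha'.le (h.nonneg _))
        (mul_pos hb' (h.pos k (by omega)))
  have eq_zero : ∀ k, n + 1 + 1 < k → G k = 0 := by
    intro k hk
    obtain ⟨k, rfl⟩ : ∃ m, k = m + 1 := ⟨k - 1, by omega⟩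
    rw [hG, h.eq_zero _ (by omega), h.eq_zero _ (by omega)]
    ring
  refine ⟨hG₀, pos, eq_zero, ?_, ?_⟩
  · intro i j hij
    rcases i with _ | i
    · simp [hG₀, eq_zero (j + 1) (by omega)]
    rcases j with _ | j
    · simp [hG₀, eq_zero (i + 1 + 1) (by omega)]
    have hn : (n : ℝ) = i + j := by exact_mod_cast (by omega : n = i + j)
    have hi : 0 ≤ q * (i : ℝ) := by positivity
    have hj : 0 ≤ q * (j : ℝ) := by positivity
    have key := cross_mul_le (q := q) (δ := a - b) (α := a + q * i) (β := a + q * j) hq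
      (by linarith) (by linarith) (by linarith)
      (h.nonneg i) (h.pos i (by omega))
      (h.nonneg j) (h.pos j (by omega)) (h.nonneg (j + 1 + 1))
      (h.upper (i + 1) j (by omega)) (h.upper i (j + 1) (by omega)) (h.lower i j (by omega))
    convert key using 2 <;> rw [hG, hn] <;> push_cast <;> ring
  · intro i j hij
    rcases i with _ | i
    · rw [hG₀, zero_mul]
      exact (mul_pos (pos 0 (by omega)) (pos j (by omega))).le
    rcases j with _ | j
    · rw [hG₀, mul_zero]
      exact (mul_pos (pos (i + 1) (by omega)) (pos 0 (by omega))).le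
    have hn : (n : ℝ) = i + j + 1 := by exact_mod_cast (by omega : n = i + j + 1)
    have hi : 0 ≤ q * (i : ℝ) := by positivity
    have hj : 0 ≤ q * (j : ℝ) := by positivity
    have key := cross_mul_le (q := q) (δ := b + q - a) (α := b + q + q * j)
      (β := b + q + q * i) hq
      (by linarith) (by linarith) (by linarith)
      (h.nonneg (i + 1 + 1)) (h.pos i (by omega))
      (h.nonneg (j + 1 + 1)) (h.pos j (by omega)) (h.nonneg j)
      (h.lower i (j + 1) (by omega)) (h.lower (i + 1) j (by omega))
      (h.upper (i + 1) (j + 1) (by omega))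
    convert key using 2 <;> rw [hG, hn] <;> push_cast <;> ring

lemma CrossMonotone.natDegree_eq {n : ℕ} {p : ℝ[X]}
    (h : CrossMonotone n fun k ↦ (X * p).coeff k) : p.natDegree = n := by
  refine natDegree_eq_of_le_of_coeff_ne_zero (natDegree_le_iff_coeff_eq_zero.2 ?_) ?_
  · intro k hk
    simpa [coeff_X_mul] using h.eq_zero (k + 1) (by omega)
  · simpa [coeff_X_mul] using (h.pos n le_rfl).ne'

lemma CrossMonotone.ratioMonotone {n : ℕ} {p : ℝ[X]} (hn : 1 ≤ n)
    (h : CrossMonotone n fun k ↦ (X * p).coeff k) : RatioMonotone p := by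
  have pos : ∀ i ≤ n, 0 < p.coeff i := by simpa only [coeff_X_mul] using h.pos
  have upper : ∀ i j, i + j + 1 = n →
      p.coeff (i + 1) * p.coeff (j + 1) ≤ p.coeff i * p.coeff j := by
    intro i j hij
    simpa only [coeff_X_mul] using h.upper (i + 1) (j + 1) (by omega)
  have lower : ∀ i j, i + j + 2 = n →
      p.coeff i * p.coeff j ≤ p.coeff (i + 1) * p.coeff (j + 1) := by
    intro i j hij
    simpa only [coeff_X_mul] using h.lower (i + 1) (j + 1) (by omega)
  rw [RatioMonotone, h.natDegree_eq]
  refine ⟨pos, ?_, ?_, ?_, ?_⟩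
  · intro i hi
    rw [div_le_div_iff₀ (pos _ (by omega)) (pos _ (by omega))]
    have := upper i (n - (i + 1)) (by omega)
    rw [show n - (i + 1) + 1 = n - i by omega] at this
    linarith
  · rw [div_le_one (pos _ (by omega))]
    obtain ⟨m, rfl | rfl⟩ : ∃ m, n = 2 * m + 1 ∨ n = 2 * m + 2 := ⟨(n - 1) / 2, by omega⟩
    · have := upper m m (by omega)
      rw [show (2 * m + 1 - 1) / 2 = m by omega, show 2 * m + 1 - m = m + 1 by omega]
      exact (mul_self_le_mul_self_iff (pos (m + 1) (by omega)).le (pos m (by omega)).le).2 this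
    · have := upper m (m + 1) (by omega)
      rw [show (2 * m + 2 - 1) / 2 = m by omega, show 2 * m + 2 - m = m + 1 + 1 by omega]
      refine le_of_mul_le_mul_left ?_ (pos (m + 1) (by omega))
      linarith
  · intro i hi
    rw [div_le_div_iff₀ (pos _ (by omega)) (pos _ (by omega))]
    have := lower i (n - 1 - (i + 1)) (by omega)
    rwa [show n - 1 - (i + 1) + 1 = n - 1 - i by omega] at this
  · intro hn'
    rw [div_le_one (pos _ (by omega))]
    obtain ⟨m, rfl | rfl⟩ : ∃ m, n = 2 * m + 2 ∨ n = 2 * m + 3 := ⟨n / 2 - 1, by omega⟩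
    · have := lower m m (by omega)
      rw [show (2 * m + 2) / 2 = m + 1 by omega, show 2 * m + 2 - (m + 1) = m + 1 by omega,
        Nat.add_sub_cancel]
      exact (mul_self_le_mul_self_iff (pos m (by omega)).le (pos (m + 1) (by omega)).le).2 this
    · have := lower m (m + 1) (by omega)
      rw [show (2 * m + 3) / 2 = m + 1 by omega, show 2 * m + 3 - (m + 1) = m + 1 + 1 by omega,
        Nat.add_sub_cancel]
      refine le_of_mul_le_mul_right (a := p.coeff (m + 1)) ?_ (pos (m + 1) (by omega))
      linarith

lemma coeff_recurrence (A p q : ℝ) (f : ℝ[X]) (k : ℕ) :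
    ((C A * X + C p) * f + C q * X * (1 - X) * derivative f).coeff k =
      (p + q * k) * f.coeff k + (A + q - q * k) * (X * f).coeff k := by
  have e : (C A * X + C p) * f + C q * X * (1 - X) * derivative f =
      C A * (X * f) + C p * f + C q * (X * derivative f) - C q * (X * (X * derivative f)) := by
    ring
  rw [e]
  rcases k with _ | _ | k <;>
    simp [coeff_X_mul, coeff_derivative, mul_coeff_zero] <;> ring

/-- for positive integers `p, q, r` with `q(1 + r) ≥ 2p ≥ q r > p > 0`,
the polynomials defined by
`P (n+1) = (q n X + (q r − p) X + p) P n + q X (1 − X) (P n)'`, `P 0 = 1`,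
have degree `n` and are ratio monotone for all `n ≥ 1`. -/
theorem stmt5 (p q r : ℕ) (hp : 0 < p) (hq : 0 < q) (hr : 0 < r)
    (h1 : 2 * p ≤ q * (1 + r)) (h2 : q * r ≤ 2 * p) (h3 : p < q * r)
    (P : ℕ → Polynomial ℝ) (hP0 : P 0 = 1)
    (hrec : ∀ n : ℕ, P (n + 1) =
      (Polynomial.C ((q : ℝ) * n + ((q : ℝ) * r - (p : ℝ))) * Polynomial.X +
          Polynomial.C (p : ℝ)) * P n +
        Polynomial.C (q : ℝ) * Polynomial.X * (1 - Polynomial.X) *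
          Polynomial.derivative (P n)) :
    ∀ n : ℕ, 1 ≤ n → (P n).natDegree = n ∧ RatioMonotone (P n) := by
  have hq' : (0 : ℝ) < q := by exact_mod_cast hq
  have hp' : (0 : ℝ) < p := by exact_mod_cast hp
  have h1' : 2 * (p : ℝ) ≤ q * (1 + r) := by exact_mod_cast h1
  have h2' : (q : ℝ) * r ≤ 2 * p := by exact_mod_cast h2
  have h3' : (p : ℝ) < q * r := by exact_mod_cast h3
  have main : ∀ n, CrossMonotone n fun k ↦ (X * P n).coeff k := by
    intro n
    induction n with
    | zero =>
      refine ⟨by simp, ?_, ?_, ?_, ?_⟩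
      · intro k hk
        obtain rfl : k = 0 := by omega
        simp [hP0]
      · intro k hk
        simp [hP0, coeff_X, show 1 ≠ k by omega]
      · intro i j hij
        obtain ⟨rfl, rfl⟩ | ⟨rfl, rfl⟩ : i = 0 ∧ j = 1 ∨ i = 1 ∧ j = 0 := by omega
        all_goals simp [hP0, coeff_X]
      · intro i j hij
        obtain ⟨rfl, rfl⟩ : i = 0 ∧ j = 0 := by omega
        simp [hP0]
    | succ n ih =>
      refine ih.succ (q := q) (a := p) (b := q * r - p) hq'.le hp' (by linarith)
        (by linarith) (by linarith) (by simp) fun k ↦ ?_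
      simp only [coeff_X_mul (p := P n), coeff_X_mul (p := P (n + 1))]
      rw [hrec, coeff_recurrence]
      ring
  exact fun n hn ↦ ⟨(main n).natDegree_eq, (main n).ratioMonotone hn⟩
end

section
/- Let p, q be real numbers with 1 + q ≥ p ≥ q > 0 and let (P_n(x;p,q))_{n≥0} be the generalized Eulerian polynomials of Carlitz–Scoville, defined by P_0(x;p,q) = 1 and P_{n+1}(x;p,q) = (n x + p x + q) P_n(x;p,q) + x(1 − x) ∂_x P_n(x;p,q) for n ≥ 0, so that deg P_n(x;p,q) = n. Then for every n ≥ 1, P_n(x;p,q) is bi-gamma-positive and the reciprocal polynomial x^n P_n(1/x;p,q) is ratio monotone. -/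
open Polynomial

/-- The cone spanned by the polynomials `X ^ k * (1 + X) ^ (d - 2 * k)`. -/
noncomputable def gammaCone (d : ℕ) : AddSubmonoid (Polynomial ℝ) :=
  AddSubmonoid.closure {f | ∃ (c : ℝ) (k j : ℕ), 0 ≤ c ∧ 2 * k + j = d ∧
    f = C c * X ^ k * (1 + X) ^ j}

theorem mem_gammaCone {c : ℝ} {d k j : ℕ} (hc : 0 ≤ c) (h : 2 * k + j = d) :
    C c * X ^ k * (1 + X) ^ j ∈ gammaCone d :=
  AddSubmonoid.subset_closure ⟨c, k, j, hc, h, rfl⟩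

theorem C_mul_mem_gammaCone {d : ℕ} {f : Polynomial ℝ} (hf : f ∈ gammaCone d) {c : ℝ}
    (hc : 0 ≤ c) : C c * f ∈ gammaCone d := by
  induction hf using AddSubmonoid.closure_induction with
  | mem f hf =>
    obtain ⟨e, k, j, he, h, rfl⟩ := hf
    convert mem_gammaCone (mul_nonneg hc he) h using 1
    rw [C_mul]; ring
  | zero => simp
  | add f g _ _ hf hg => rw [mul_add]; exact add_mem hf hg

theorem X_mul_mem_gammaCone {d : ℕ} {f : Polynomial ℝ} (hf : f ∈ gammaCone d) :
    X * f ∈ gammaCone (d + 2) := by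
  induction hf using AddSubmonoid.closure_induction with
  | mem f hf =>
    obtain ⟨c, k, j, hc, h, rfl⟩ := hf
    convert mem_gammaCone (k := k + 1) (j := j) (d := d + 2) hc (by omega) using 1
    ring
  | zero => simp
  | add f g _ _ hf hg => rw [mul_add]; exact add_mem hf hg

theorem eulerian_step_mem_gammaCone {d : ℕ} {f : Polynomial ℝ} (hf : f ∈ gammaCone d) {c : ℝ}
    (hc : 0 ≤ c) :
    (C (d : ℝ) * X + C c * (1 + X)) * f + X * (1 - X) * derivative f ∈ gammaCone (d + 1) := by
  induction hf using AddSubmonoid.closure_induction with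
  | mem f hf =>
    obtain ⟨e, k, j, he, rfl, rfl⟩ := hf
    have h1 : C ((c + k) * e) * X ^ k * (1 + X) ^ (j + 1) ∈ gammaCone (2 * k + j + 1) :=
      mem_gammaCone (by positivity) (by omega)
    have h2 : C (2 * j * e) * X ^ (k + 1) * (1 + X) ^ (j - 1) ∈ gammaCone (2 * k + j + 1) := by
      rcases j with _ | j
      · simp
      · exact mem_gammaCone (by positivity) (by simp; omega)
    convert add_mem h1 h2 using 1
    simp only [derivative_mul, derivative_C, derivative_pow, derivative_add,
      derivative_one, derivative_X, C_mul, C_add, map_natCast, map_ofNat, Nat.cast_add,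
      Nat.cast_mul, Nat.cast_ofNat]
    rcases k with _ | k <;> rcases j with _ | j <;>
      simp only [Nat.cast_zero, Nat.cast_add, Nat.cast_one, Nat.add_sub_cancel] <;> ring
  | zero => simp
  | add f g _ _ hf hg =>
    convert add_mem hf hg using 1
    rw [derivative_add]; ring

theorem reflect_one_add_X_pow (j : ℕ) :
    reflect j ((1 + X : Polynomial ℝ) ^ j) = (1 + X) ^ j := by
  ext i
  rw [coeff_reflect, coeff_one_add_X_pow, coeff_one_add_X_pow]
  rcases le_or_gt i j with h | h
  · rw [revAt_le h, Nat.choose_symm h]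
  · rw [revAt_eq_self_of_lt h]

theorem natDegree_one_add_X_pow_le (j : ℕ) : ((1 + X : Polynomial ℝ) ^ j).natDegree ≤ j := by
  compute_degree

theorem natDegree_le_of_mem_gammaCone {d : ℕ} {f : Polynomial ℝ} (hf : f ∈ gammaCone d) :
    f.natDegree ≤ d := by
  induction hf using AddSubmonoid.closure_induction with
  | mem f hf =>
    obtain ⟨c, k, j, hc, rfl, rfl⟩ := hf
    exact (natDegree_mul_le_of_le (natDegree_C_mul_X_pow_le c k)
      (natDegree_one_add_X_pow_le j)).trans (by omega)
  | zero => simp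
  | add f g _ _ hf hg => exact natDegree_add_le_of_degree_le hf hg

theorem reflect_of_mem_gammaCone {d : ℕ} {f : Polynomial ℝ} (hf : f ∈ gammaCone d) :
    reflect d f = f := by
  induction hf using AddSubmonoid.closure_induction with
  | mem f hf =>
    obtain ⟨c, k, j, hc, rfl, rfl⟩ := hf
    rw [reflect_mul _ _ ((natDegree_C_mul_X_pow_le c k).trans (by omega))
      (natDegree_one_add_X_pow_le j), reflect_one_add_X_pow, reflect_C_mul_X_pow,
      revAt_le (by omega), two_mul, Nat.add_sub_cancel]
  | zero => simp
  | add f g _ _ hf hg => rw [reflect_add, hf, hg]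

theorem exists_gamma_of_mem_gammaCone {d : ℕ} {f : Polynomial ℝ} (hf : f ∈ gammaCone d) :
    ∃ γ : ℕ → ℝ, (∀ k, 0 ≤ γ k) ∧
      f = ∑ k ∈ Finset.range (d / 2 + 1), C (γ k) * X ^ k * (1 + X) ^ (d - 2 * k) := by
  induction hf using AddSubmonoid.closure_induction with
  | mem f hf =>
    obtain ⟨c, k, j, hc, rfl, rfl⟩ := hf
    refine ⟨fun i => if i = k then c else 0, fun i => ?_, ?_⟩
    · dsimp only
      split_ifs <;> simp [hc]
    · rw [Finset.sum_eq_single_of_mem k (by rw [Finset.mem_range]; omega)]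
      · simp
      · intro i _ hi
        simp [hi]
  | zero => exact ⟨0, by simp, by simp⟩
  | add f g _ _ hf hg =>
    obtain ⟨γ, hγ, rfl⟩ := hf
    obtain ⟨η, hη, rfl⟩ := hg
    refine ⟨γ + η, fun k => add_nonneg (hγ k) (hη k), ?_⟩
    rw [← Finset.sum_add_distrib]
    refine Finset.sum_congr rfl fun k _ => ?_
    rw [Pi.add_apply, C_add]; ring

theorem gammaPositive_of_mem_gammaCone {d : ℕ} {f : Polynomial ℝ} (hf : f ∈ gammaCone d)
    (h0 : f = 0 ∨ f.coeff 0 ≠ 0) : GammaPositive f := by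
  rcases h0 with rfl | h0
  · exact ⟨0, by simp, by simp⟩
  · have hd : f.natDegree = d := by
      refine natDegree_eq_of_le_of_coeff_ne_zero (natDegree_le_of_mem_gammaCone hf) ?_
      rw [← reflect_of_mem_gammaCone hf, coeff_reflect, revAt_le le_rfl, Nat.sub_self]
      exact h0
    rw [GammaPositive, hd]
    exact exists_gamma_of_mem_gammaCone hf

theorem biGammaPositive_of_decomposition {m : ℕ} {f a b : Polynomial ℝ}
    (hdeg : f.natDegree = m + 1) (hf : f = a + X * b) (ha : a ∈ gammaCone (m + 1))
    (hb : b ∈ gammaCone m) (ha0 : a = 0 ∨ a.coeff 0 ≠ 0) (hb0 : b = 0 ∨ b.coeff 0 ≠ 0) :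
    BiGammaPositive f := by
  have hr : reflect f.natDegree f = a + b := by
    rw [hdeg, hf, reflect_add, reflect_of_mem_gammaCone ha, add_comm m 1,
      reflect_mul _ _ natDegree_X_le (natDegree_le_of_mem_gammaCone hb),
      reflect_of_mem_gammaCone hb, reflect_one_X, one_mul]
  refine ⟨a, b, ?_, ?_, gammaPositive_of_mem_gammaCone ha ha0,
    gammaPositive_of_mem_gammaCone hb hb0⟩
  · rw [hr, hf]; ring
  · rw [hr, hf]; ring

theorem eulerian_decomposition (p q : ℝ) (hq : 0 < q) (hpq : q ≤ p) (hp1 : p ≤ 1 + q)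
    (P : ℕ → Polynomial ℝ) (hP0 : P 0 = 1)
    (hrec : ∀ n : ℕ, P (n + 1) =
      (C ((n : ℝ) + p) * X + C q) * P n + X * (1 - X) * derivative (P n)) (m : ℕ) :
    ∃ a b : Polynomial ℝ, P (m + 1) = a + X * b ∧ a ∈ gammaCone (m + 1) ∧ b ∈ gammaCone m ∧
      0 < a.coeff 0 ∧ 0 ≤ b.coeff 0 ∧ (b = 0 ∨ 0 < b.coeff 0) := by
  induction m with
  | zero =>
    refine ⟨C q * (1 + X), C (p - q), ?_, ?_, ?_, ?_, ?_, ?_⟩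
    · rw [hrec, hP0]
      simp
      ring
    · simpa using mem_gammaCone (c := q) (d := 0 + 1) (k := 0) (j := 1) hq.le rfl
    · simpa using mem_gammaCone (c := p - q) (d := 0) (k := 0) (j := 0) (by linarith) rfl
    · simpa using hq
    · simpa using hpq
    · rcases hpq.eq_or_lt with rfl | h
      · simp
      · right; simpa using h
  | succ m ih =>
    obtain ⟨a, b, hab, ha, hb, ha0, hb0, hb1⟩ := ih
    have hp : 0 < p := hq.trans_le hpq
    refine ⟨((C ((m + 1 : ℕ) : ℝ) * X + C q * (1 + X)) * a + X * (1 - X) * derivative a) +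
        C (1 + q - p) * (X * b),
      ((C (m : ℝ) * X + C p * (1 + X)) * b + X * (1 - X) * derivative b) + C (p - q) * a,
      ?_, ?_, ?_, ?_, ?_, ?_⟩
    · rw [hrec, hab]
      simp only [derivative_add, derivative_mul, derivative_X, C_add, C_sub, map_natCast,
        Nat.cast_add, Nat.cast_one, C_1]
      ring
    · exact add_mem (eulerian_step_mem_gammaCone ha hq.le)
        (C_mul_mem_gammaCone (X_mul_mem_gammaCone hb) (by linarith))
    · exact add_mem (eulerian_step_mem_gammaCone hb hp.le)
        (C_mul_mem_gammaCone ha (by linarith))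
    · simp [mul_coeff_zero]
      positivity
    · simp [mul_coeff_zero]
      have := mul_nonneg (sub_nonneg.2 hpq) ha0.le
      positivity
    · rcases hb1 with rfl | hb1
      · rcases hpq.eq_or_lt with rfl | h
        · simp
        · right
          simpa [mul_coeff_zero] using mul_pos (sub_pos.2 h) ha0
      · right
        simp [mul_coeff_zero]
        have := mul_nonneg (sub_nonneg.2 hpq) ha0.le
        positivity

theorem spiral_mul_le_mul {a b δ x₀ x₁ x₂ x₃ x₄ x₅ : ℝ} (ha : 0 ≤ a) (hb : 0 ≤ b) (hδ : 0 ≤ δ)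
    (h₀ : 0 ≤ x₀) (h₁ : 0 ≤ x₁) (h₂ : 0 < x₂) (h₃ : 0 < x₃) (h₄ : 0 < x₄) (h₅ : 0 < x₅)
    (h₀₃ : x₀ * x₃ ≤ x₁ * x₂) (h₁₄ : x₁ * x₄ ≤ x₂ * x₃) (h₂₅ : x₂ * x₅ ≤ x₃ * x₄) :
    (a * x₂ + (b + 1 + δ) * x₀) * ((a + 1 + δ) * x₅ + b * x₃) ≤
      ((a + δ) * x₃ + (b + 1) * x₁) * ((a + 1) * x₄ + (b + δ) * x₂) := by
  have hZY : x₀ * x₅ ≤ x₁ * x₄ := by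
    have h := mul_le_mul h₀₃ h₂₅ (by positivity) (by positivity)
    refine le_of_mul_le_mul_right (a := x₂ * x₃) ?_ (by positivity)
    nlinarith
  have hZX : x₀ * x₅ ≤ x₂ * x₃ := hZY.trans h₁₄
  have hAG : 2 * (x₀ * x₅) ≤ x₃ * x₄ + x₁ * x₂ := by
    have h : (x₀ * x₅) * (x₀ * x₅) ≤ (x₁ * x₄) * (x₂ * x₃) :=
      mul_le_mul hZY hZX (by positivity) (by positivity)
    refine abs_le_of_sq_le_sq' ?_ (by positivity) |>.2
    nlinarith [sq_nonneg (x₃ * x₄ - x₁ * x₂)]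
  have e₁ := mul_le_mul_of_nonneg_left h₂₅ (show 0 ≤ a * (a + 1 + δ) by positivity)
  have e₂ := mul_le_mul_of_nonneg_left h₀₃ (show 0 ≤ b * (b + 1 + δ) by positivity)
  have e₃ := mul_le_mul_of_nonneg_left hZX
    (show 0 ≤ (a + δ) * (b + δ) - a * b by nlinarith [mul_nonneg ha hδ, mul_nonneg hb hδ])
  have e₄ := mul_le_mul_of_nonneg_left hZY (show 0 ≤ (b + 1) * (a + 1) by positivity)
  have e₅ := mul_le_mul_of_nonneg_left hAG hδ
  linarith

/-- The coefficients of `f` in the order `0, n, 1, n - 1, 2, …`, preceded by two zeros. -/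
noncomputable def spiral (n : ℕ) (f : Polynomial ℝ) : ℕ → ℝ
  | 0 => 0
  | 1 => 0
  | j + 2 => if Even j then f.coeff (j / 2) else f.coeff (n - j / 2)

theorem spiral_two_mul (n : ℕ) (f : Polynomial ℝ) (i : ℕ) :
    spiral n f (2 * i + 2) = f.coeff i := by
  simp [spiral]

theorem spiral_two_mul_add_one (n : ℕ) (f : Polynomial ℝ) (i : ℕ) :
    spiral n f (2 * i + 3) = f.coeff (n - i) := by
  have h : (2 * i + 1) / 2 = i := by omega
  simp [spiral, h]

theorem spiral_last (n : ℕ) (f : Polynomial ℝ) : spiral n f (n + 3) = spiral n f (n + 2) := by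
  rcases Nat.even_or_odd' n with ⟨i, rfl | rfl⟩
  · rw [spiral_two_mul, spiral_two_mul_add_one]
    congr 1; omega
  · rw [show 2 * i + 1 + 3 = 2 * (i + 1) + 2 by ring, spiral_two_mul,
      show 2 * i + 1 + 2 = 2 * i + 3 by ring, spiral_two_mul_add_one]
    congr 1; omega

theorem eulerian_coeff_succ {p q : ℝ} {n : ℕ} {f g : Polynomial ℝ}
    (h : g = (C ((n : ℝ) + p) * X + C q) * f + X * (1 - X) * derivative f) (k : ℕ) :
    g.coeff (k + 1) = (n + p - k) * f.coeff k + (q + (k + 1)) * f.coeff (k + 1) := by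
  have h' : g = C ((n : ℝ) + p) * (X * f) + C q * f + X * derivative f
      - X * (X * derivative f) := by rw [h]; ring
  rw [h']
  rcases k with _ | k
  · simp only [coeff_add, coeff_sub, coeff_C_mul, coeff_X_mul, coeff_derivative, coeff_X_mul_zero]
    push_cast
    ring
  · simp only [coeff_add, coeff_sub, coeff_C_mul, coeff_X_mul, coeff_derivative]
    push_cast
    ring

theorem eulerian_coeff_zero {p q : ℝ} {n : ℕ} {f g : Polynomial ℝ}
    (h : g = (C ((n : ℝ) + p) * X + C q) * f + X * (1 - X) * derivative f) :
    g.coeff 0 = q * f.coeff 0 := by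
  simp [h, mul_coeff_zero]

theorem spiral_eulerian {p q : ℝ} {n : ℕ} {f g : Polynomial ℝ} (hf : f.natDegree ≤ n)
    (h : g = (C ((n : ℝ) + p) * X + C q) * f + X * (1 - X) * derivative f) :
    (∀ i, 2 * i ≤ n + 1 → spiral (n + 1) g (2 * i + 2) =
      (q + i) * spiral n f (2 * i + 2) + (n + 1 - i + p) * spiral n f (2 * i)) ∧
    (∀ i, 2 * i + 1 ≤ n + 1 → spiral (n + 1) g (2 * i + 3) =
      (p + i) * spiral n f (2 * i + 3) + (n + 1 - i + q) * spiral n f (2 * i + 1)) := by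
  constructor
  · intro i hi
    rw [spiral_two_mul, spiral_two_mul]
    rcases i with _ | i
    · simp [spiral, eulerian_coeff_zero h]
    · rw [eulerian_coeff_succ h, mul_add 2 i 1, spiral_two_mul]
      push_cast
      ring
  · intro i hi
    rw [spiral_two_mul_add_one, spiral_two_mul_add_one]
    obtain ⟨k, rfl⟩ := Nat.exists_eq_add_of_le (show i ≤ n by omega)
    rw [show i + k + 1 - i = k + 1 by omega, show i + k - i = k by omega, eulerian_coeff_succ h]
    rcases i with _ | i
    · rw [coeff_eq_zero_of_natDegree_lt (show f.natDegree < k + 1 by omega)]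
      simp [spiral]
    · rw [show 2 * (i + 1) + 1 = 2 * i + 3 by ring, spiral_two_mul_add_one,
        show i + 1 + k - i = k + 1 by omega]
      push_cast
      ring

theorem exists_spiral_eulerian_coeffs {p q : ℝ} (hq : 0 < q) (hpq : q ≤ p) (hp1 : p ≤ 1 + q)
    {n : ℕ} {f g : Polynomial ℝ} (hf : f.natDegree ≤ n)
    (h : g = (C ((n : ℝ) + p) * X + C q) * f + X * (1 - X) * derivative f) (j : ℕ) :
    ∃ a b δ : ℝ, 0 < a ∧ 0 ≤ δ ∧ (j ≤ n + 1 → 0 ≤ b + 1) ∧ (j + 3 ≤ n + 1 → 0 ≤ b) ∧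
      (j ≤ n + 1 → spiral (n + 1) g (j + 2) =
        a * spiral n f (j + 2) + (b + 1 + δ) * spiral n f j) ∧
      (j + 1 ≤ n + 1 → spiral (n + 1) g (j + 3) =
        (a + δ) * spiral n f (j + 3) + (b + 1) * spiral n f (j + 1)) ∧
      (j + 2 ≤ n + 1 → spiral (n + 1) g (j + 4) =
        (a + 1) * spiral n f (j + 4) + (b + δ) * spiral n f (j + 2)) ∧
      (j + 3 ≤ n + 1 → spiral (n + 1) g (j + 5) =
        (a + 1 + δ) * spiral n f (j + 5) + b * spiral n f (j + 3)) := by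
  obtain ⟨he, ho⟩ := spiral_eulerian hf h
  rcases Nat.even_or_odd' j with ⟨i, rfl | rfl⟩
  · refine ⟨q + i, n - i + q, p - q, by positivity, by linarith,
      fun hi => ?_, fun hi => ?_, fun hi => ?_, fun hi => ?_, fun hi => ?_, fun hi => ?_⟩
    · have : (i : ℝ) ≤ n + 1 := by exact_mod_cast (by omega : i ≤ n + 1)
      linarith
    · have : (i : ℝ) ≤ n := by exact_mod_cast (by omega : i ≤ n)
      linarith
    · rw [he i hi]; ring
    · rw [ho i hi]; ring
    · have := he (i + 1) (by omega)
      push_cast [mul_add] at this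
      rw [this]; ring
    · have := ho (i + 1) (by omega)
      push_cast [mul_add] at this
      rw [this]; ring
  · refine ⟨p + i, n - 1 - i + p, 1 + q - p, by linarith [(Nat.cast_nonneg i : (0 : ℝ) ≤ i)],
      by linarith,
      fun hi => ?_, fun hi => ?_, fun hi => ?_, fun hi => ?_, fun hi => ?_, fun hi => ?_⟩
    · have : (i : ℝ) ≤ n := by exact_mod_cast (by omega : i ≤ n)
      linarith
    · have : (i : ℝ) + 1 ≤ n := by exact_mod_cast (by omega : i + 1 ≤ n)
      linarith
    · rw [show 2 * i + 1 + 2 = 2 * i + 3 by ring, ho i hi]; ring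
    · have := he (i + 1) (by omega)
      push_cast [mul_add] at this
      rw [show 2 * i + 1 + 3 = 2 * i + 2 + 2 by ring, this]; ring_nf
    · have := ho (i + 1) (by omega)
      push_cast [mul_add] at this
      rw [show 2 * i + 1 + 4 = 2 * i + 2 + 3 by ring, this]; ring_nf
    · have := he (i + 2) (by omega)
      push_cast [mul_add] at this
      rw [show 2 * i + 1 + 5 = 2 * i + 4 + 2 by ring, this]; ring_nf

/-- Positivity, monotonicity and ratio monotonicity of the spiral ordering. -/
structure SpiralRatioMonotone (n : ℕ) (f : Polynomial ℝ) : Prop where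
  pos : ∀ j ≤ n, 0 < spiral n f (j + 2)
  mono : ∀ j ≤ n + 1, spiral n f j ≤ spiral n f (j + 1)
  ratio : ∀ j, j + 1 ≤ n →
    spiral n f j * spiral n f (j + 3) ≤ spiral n f (j + 1) * spiral n f (j + 2)

theorem SpiralRatioMonotone.eulerian {p q : ℝ} (hq : 0 < q) (hpq : q ≤ p) (hp1 : p ≤ 1 + q)
    {n : ℕ} {f g : Polynomial ℝ} (hf : f.natDegree ≤ n) (H : SpiralRatioMonotone n f)
    (h : g = (C ((n : ℝ) + p) * X + C q) * f + X * (1 - X) * derivative f) :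
    SpiralRatioMonotone (n + 1) g := by
  have hpos : ∀ j ≤ n + 1, 0 < spiral n f (j + 2) := by
    intro j hj
    rcases Nat.lt_or_ge n j with hj' | hj'
    · obtain rfl : j = n + 1 := by omega
      have := H.pos n le_rfl
      rwa [← spiral_last] at this
    · exact H.pos j hj'
  have hnn : ∀ j ≤ n + 3, 0 ≤ spiral n f j := by
    intro j hj
    rcases j with _ | _ | j
    · exact le_rfl
    · exact le_rfl
    · exact (hpos j (by omega)).le
  have hmono : ∀ j ≤ n + 2, spiral n f j ≤ spiral n f (j + 1) := by
    intro j hj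
    rcases Nat.lt_or_ge (n + 1) j with hj' | hj'
    · obtain rfl : j = n + 2 := by omega
      exact (spiral_last n f).ge
    · exact H.mono j hj'
  have hratio : ∀ j ≤ n, spiral n f j * spiral n f (j + 3) ≤
      spiral n f (j + 1) * spiral n f (j + 2) := by
    intro j hj
    rcases hj.eq_or_lt with rfl | hj'
    · rw [spiral_last]
      exact mul_le_mul_of_nonneg_right (H.mono j (by omega)) (hnn _ (by omega))
    · exact H.ratio j hj'
  have hpos' : ∀ j ≤ n + 1, 0 < spiral (n + 1) g (j + 2) := by
    intro j hj
    obtain ⟨a, b, δ, ha, hδ, hb, -, e, -⟩ :=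
      exists_spiral_eulerian_coeffs hq hpq hp1 hf h j
    rw [e hj]
    have := mul_nonneg (add_nonneg (hb hj) hδ) (hnn j (by omega))
    have := mul_pos ha (hpos j hj)
    linarith
  refine ⟨hpos', fun j hj => ?_, fun j hj => ?_⟩
  · rcases j with _ | _ | j
    · exact le_rfl
    · exact (hpos' 0 (by omega)).le
    · obtain ⟨a, b, δ, ha, hδ, hb, -, e₀, e₁, -⟩ :=
        exists_spiral_eulerian_coeffs hq hpq hp1 hf h j
      rw [e₀ (by omega), show j + 2 + 1 = j + 3 by ring, e₁ (by omega)]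
      have m₀ := hmono j (by omega)
      have m₁ := hmono (j + 1) (by omega)
      have m₂ := hmono (j + 2) (by omega)
      have t₁ := mul_le_mul_of_nonneg_left m₀ (hb (by omega))
      have t₂ := mul_le_mul_of_nonneg_left m₂ ha.le
      have t₃ := mul_le_mul_of_nonneg_left (m₀.trans (m₁.trans m₂)) hδ
      linarith
  · rcases j with _ | _ | j
    · simp [spiral]
    · have := mul_nonneg (hpos' 0 (by omega)).le (hpos' 1 (by omega)).le
      simpa [spiral] using this
    · obtain ⟨a, b, δ, ha, hδ, -, hb, e₀, e₁, e₂, e₃⟩ :=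
        exists_spiral_eulerian_coeffs hq hpq hp1 hf h j
      rw [show j + 2 + 3 = j + 5 by ring, show j + 2 + 1 = j + 3 by ring,
        show j + 2 + 2 = j + 4 by ring, e₀ (by omega), e₁ (by omega), e₂ (by omega),
        e₃ (by omega)]
      exact spiral_mul_le_mul ha.le (hb (by omega)) hδ (hnn _ (by omega)) (hnn _ (by omega))
        (hpos j (by omega)) (hpos (j + 1) (by omega)) (hpos (j + 2) (by omega))
        (hpos (j + 3) (by omega)) (hratio j (by omega)) (hratio (j + 1) (by omega))
        (hratio (j + 2) (by omega))

theorem spiralRatioMonotone_one : SpiralRatioMonotone 0 1 := by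
  refine ⟨fun j hj => ?_, fun j hj => ?_, fun j hj => by omega⟩
  · obtain rfl : j = 0 := by omega
    simp [spiral]
  · interval_cases j <;> simp [spiral]

theorem SpiralRatioMonotone.coeff_pos {n : ℕ} {f : Polynomial ℝ} (H : SpiralRatioMonotone n f)
    {i : ℕ} (hi : i ≤ n) : 0 < f.coeff i := by
  rcases le_or_gt (2 * i) n with h | h
  · have := H.pos (2 * i) h
    rwa [spiral_two_mul] at this
  · have := H.pos (2 * (n - i) + 1) (by omega)
    rwa [show 2 * (n - i) + 1 + 2 = 2 * (n - i) + 3 by ring, spiral_two_mul_add_one,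
      Nat.sub_sub_self hi] at this

theorem SpiralRatioMonotone.ratioMonotone_reflect {n : ℕ} {f : Polynomial ℝ}
    (H : SpiralRatioMonotone n f) (hf : f.natDegree ≤ n) (hn : 1 ≤ n) :
    RatioMonotone (reflect n f) := by
  have hc : ∀ i ≤ n, (reflect n f).coeff i = f.coeff (n - i) := fun i hi => by
    rw [coeff_reflect, revAt_le hi]
  have hd : (reflect n f).natDegree = n := by
    refine natDegree_eq_of_le_of_coeff_ne_zero (natDegree_le_iff_coeff_eq_zero.2 ?_) ?_
    · intro i hi
      rw [coeff_reflect, revAt_eq_self_of_lt hi]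
      exact coeff_eq_zero_of_natDegree_lt (by omega)
    · rw [hc n le_rfl, Nat.sub_self]
      exact (H.coeff_pos (Nat.zero_le n)).ne'
  rw [RatioMonotone, hd]
  refine ⟨fun i hi => ?_, fun i hi => ?_, ?_, fun i hi => ?_, fun hi => ?_⟩
  · rw [hc i hi]
    exact H.coeff_pos (by omega)
  · rw [hc _ (by omega), hc _ (by omega), hc _ (by omega), hc _ (by omega),
      div_le_div_iff₀ (H.coeff_pos (by omega)) (H.coeff_pos (by omega)),
      Nat.sub_sub_self (by omega), Nat.sub_sub_self (by omega)]
    have := H.ratio (2 * i + 2) (by omega)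
    rw [show 2 * i + 2 + 3 = 2 * (i + 1) + 3 by ring, show 2 * i + 2 + 1 = 2 * i + 3 by ring,
      show 2 * i + 2 + 2 = 2 * (i + 1) + 2 by ring, spiral_two_mul, spiral_two_mul,
      spiral_two_mul_add_one, spiral_two_mul_add_one] at this
    linarith
  · rw [hc _ (by omega), hc _ (by omega), div_le_one (H.coeff_pos (by omega)),
      Nat.sub_sub_self (by omega)]
    have := H.mono (2 * ((n - 1) / 2) + 2) (by omega)
    rwa [show 2 * ((n - 1) / 2) + 2 + 1 = 2 * ((n - 1) / 2) + 3 by ring, spiral_two_mul,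
      spiral_two_mul_add_one] at this
  · rw [hc _ (by omega), hc _ (by omega), hc _ (by omega), hc _ (by omega),
      div_le_div_iff₀ (H.coeff_pos (by omega)) (H.coeff_pos (by omega)),
      show n - (n - 1 - i) = i + 1 by omega, show n - (n - 1 - (i + 1)) = i + 2 by omega]
    have := H.ratio (2 * i + 3) (by omega)
    rw [show 2 * i + 3 + 3 = 2 * (i + 2) + 2 by ring,
      show 2 * i + 3 + 1 = 2 * (i + 1) + 2 by ring,
      show 2 * i + 3 + 2 = 2 * (i + 1) + 3 by ring, spiral_two_mul, spiral_two_mul,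
      spiral_two_mul_add_one, spiral_two_mul_add_one] at this
    linarith
  · rw [hc _ (by omega), hc _ (by omega), div_le_one (H.coeff_pos (by omega)),
      Nat.sub_sub_self (by omega)]
    have := H.mono (2 * (n / 2 - 1) + 3) (by omega)
    rwa [show 2 * (n / 2 - 1) + 3 + 1 = 2 * (n / 2) + 2 by omega, spiral_two_mul,
      spiral_two_mul_add_one] at this

/-- for `1 + q ≥ p ≥ q > 0`, the Carlitz–Scoville generalized
Eulerian polynomials `P n` are bi-gamma-positive and their reciprocals
`X^n * (P n)(1/X)` are ratio monotone for `n ≥ 1`. -/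
theorem stmt15 (p q : ℝ) (hq : 0 < q) (hpq : q ≤ p) (hp1 : p ≤ 1 + q)
    (P : ℕ → Polynomial ℝ) (hP0 : P 0 = 1)
    (hrec : ∀ n : ℕ, P (n + 1) =
      (Polynomial.C ((n : ℝ) + p) * Polynomial.X + Polynomial.C q) * P n +
        Polynomial.X * (1 - Polynomial.X) * Polynomial.derivative (P n))
    (hdeg : ∀ n : ℕ, (P n).natDegree = n) :
    ∀ n : ℕ, 1 ≤ n → BiGammaPositive (P n) ∧
      RatioMonotone (Polynomial.reflect n (P n)) := by
  intro n hn
  have H : ∀ k, SpiralRatioMonotone k (P k) := by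
    intro k
    induction k with
    | zero => rw [hP0]; exact spiralRatioMonotone_one
    | succ k ih => exact ih.eulerian hq hpq hp1 (hdeg k).le (hrec k)
  refine ⟨?_, (H n).ratioMonotone_reflect (hdeg n).le hn⟩
  obtain ⟨m, rfl⟩ := Nat.exists_eq_add_of_le' hn
  obtain ⟨a, b, hab, ha, hb, ha0, -, hb0⟩ := eulerian_decomposition p q hq hpq hp1 P hP0 hrec m
  exact biGammaPositive_of_decomposition (hdeg _) hab ha hb (Or.inr ha0.ne')
    (hb0.imp_right ne_of_gt)
end
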